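/- (Main Theorem, case i = 3.) Let x, x' be distinct nonsingular vectors of V(2n,2), and let (P, H) = f(x), (P', H') = f(x'). Then Q(x + x') = 0 together with (x + x' ∈ Π or x + x' ∈ Σ) (relation C₃) holds if and only if either P = P' and H ≠ H', or P ≠ P' and H = H' (relation A₃). -/

import Mathlib

/-- The hyperbolic quadratic form on `V(2n,2)`:
`Q x = ∑_{i=0}^{n-1} x (2i) * x (2i+1)`. -/
def Q (n : ℕ) (x : Fin (2*n) → ZMod 2) : ZMod 2 :=
  ∑ i : Fin n, x ⟨2*i.1, by have := i.2; omega⟩ * x ⟨2*i.1+1, by have := i.2; omega⟩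

/-- The bilinear form associated with `Q`: `B u v = Q (u+v) + Q u + Q v`. -/
def B (n : ℕ) (u v : Fin (2*n) → ZMod 2) : ZMod 2 :=
  Q n (u + v) + Q n u + Q n v

lemma B_eq (n : ℕ) (u v : Fin (2*n) → ZMod 2) :
    B n u v = ∑ i : Fin n,
      (u ⟨2*i.1, by have := i.2; omega⟩ * v ⟨2*i.1+1, by have := i.2; omega⟩
        + u ⟨2*i.1+1, by have := i.2; omega⟩ * v ⟨2*i.1, by have := i.2; omega⟩) := by
  have key : ∀ a b c d : ZMod 2, (a+c)*(b+d) + a*b + c*d = a*d + c*b := by decide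
  simp only [B, Q, Pi.add_apply, ← Finset.sum_add_distrib]
  exact Finset.sum_congr rfl fun i _ => by rw [key]; ring

lemma B_add_left (n : ℕ) (u v w : Fin (2*n) → ZMod 2) :
    B n (u + v) w = B n u w + B n v w := by
  simp only [B_eq, Pi.add_apply, ← Finset.sum_add_distrib]
  exact Finset.sum_congr rfl fun i _ => by ring

lemma B_smul_left (n : ℕ) (c : ZMod 2) (v w : Fin (2*n) → ZMod 2) :
    B n (c • v) w = c * B n v w := by
  simp only [B_eq, Pi.smul_apply, smul_eq_mul, Finset.mul_sum]
  exact Finset.sum_congr rfl fun i _ => by ring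

/-- The perp `S^⊥ = {v : B v s = 0 for all s ∈ S}` of a subspace `S`
with respect to the bilinear form `B`. -/
def perp (n : ℕ) (S : Submodule (ZMod 2) (Fin (2*n) → ZMod 2)) :
    Submodule (ZMod 2) (Fin (2*n) → ZMod 2) where
  carrier := {v | ∀ s ∈ S, B n v s = 0}
  zero_mem' := by intro s _; simp [B_eq]
  add_mem' := by
    intro a b ha hb s hs
    rw [B_add_left, ha s hs, hb s hs, add_zero]
  smul_mem' := by
    intro c v hv s hs
    rw [B_smul_left, hv s hs, mul_zero]

/-- `Π`, the span of the even-indexed standard basis vectors `e_{2i}`,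
a maximal totally singular subspace. -/
def PiSub (n : ℕ) : Submodule (ZMod 2) (Fin (2*n) → ZMod 2) :=
  Submodule.span (ZMod 2) {v | ∃ j : Fin (2*n), j.1 % 2 = 0 ∧ v = Pi.single j 1}

/-- `Σ`, the span of the odd-indexed standard basis vectors `e_{2i+1}`,
a maximal totally singular subspace disjoint from `Π`. -/
def SigmaSub (n : ℕ) : Submodule (ZMod 2) (Fin (2*n) → ZMod 2) :=
  Submodule.span (ZMod 2) {v | ∃ j : Fin (2*n), j.1 % 2 = 1 ∧ v = Pi.single j 1}

/-- The map `f` sending a nonsingular vector `x` to the antiflag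
`(P, H) = ((span{x}^⊥ ⊓ Π)^⊥ ⊓ Σ, span{x}^⊥ ⊓ Σ)` of `Σ`. -/
def antiflagMap (n : ℕ) (x : Fin (2*n) → ZMod 2) :
    Submodule (ZMod 2) (Fin (2*n) → ZMod 2) × Submodule (ZMod 2) (Fin (2*n) → ZMod 2) :=
  (perp n (perp n (Submodule.span (ZMod 2) {x}) ⊓ PiSub n) ⊓ SigmaSub n,
   perp n (Submodule.span (ZMod 2) {x}) ⊓ SigmaSub n)

lemma mem_span_single_iff {ι : Type*} [Fintype ι] [DecidableEq ι] (p : ι → Prop)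
    (v : ι → ZMod 2) :
    v ∈ Submodule.span (ZMod 2) {v : ι → ZMod 2 | ∃ j, p j ∧ v = Pi.single j 1} ↔
      ∀ j, ¬ p j → v j = 0 := by
  constructor
  · intro hv j hj
    induction hv using Submodule.span_induction with
    | mem w hw =>
      obtain ⟨k, hk, rfl⟩ := hw
      exact Pi.single_eq_of_ne (fun h : j = k => hj (h ▸ hk)) 1
    | zero => rfl
    | add u w _ _ hu hw => simp [hu, hw]
    | smul c u _ hu => simp [hu]
  · intro hv
    rw [pi_eq_sum_univ' v]
    refine Submodule.sum_mem _ fun j _ => ?_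
    by_cases hj : p j
    · refine Submodule.smul_mem _ _ (Submodule.subset_span ⟨j, hj, ?_⟩)
      ext k
      simp [Pi.single_apply, eq_comm]
    · simp [hv j hj]

lemma mem_PiSub_iff (n : ℕ) (v : Fin (2*n) → ZMod 2) :
    v ∈ PiSub n ↔ ∀ i : Fin n, v ⟨2*i.1+1, by have := i.2; omega⟩ = 0 := by
  rw [PiSub, mem_span_single_iff]
  refine ⟨fun h i => h _ (by simp), fun h j hj => ?_⟩
  convert h ⟨j.1 / 2, by have := j.2; omega⟩
  simp only
  omega

lemma mem_SigmaSub_iff (n : ℕ) (v : Fin (2*n) → ZMod 2) :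
    v ∈ SigmaSub n ↔ ∀ i : Fin n, v ⟨2*i.1, by have := i.2; omega⟩ = 0 := by
  rw [SigmaSub, mem_span_single_iff]
  refine ⟨fun h i => h _ (by simp), fun h j hj => ?_⟩
  convert h ⟨j.1 / 2, by have := j.2; omega⟩
  simp only
  omega

lemma B_comm (n : ℕ) (u v : Fin (2*n) → ZMod 2) : B n u v = B n v u := by
  rw [B, B, add_comm u v]
  ring

lemma B_single_odd (n : ℕ) (u : Fin (2*n) → ZMod 2) (i : Fin n) :
    B n u (Pi.single ⟨2*i.1+1, by have := i.2; omega⟩ 1) =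
      u ⟨2*i.1, by have := i.2; omega⟩ := by
  rw [B_eq, Finset.sum_eq_single i]
  · simp
  · intro k _ hk
    have h₁ : k.1 ≠ i.1 := fun h => hk (Fin.ext h)
    have h₂ : 2 * k.1 ≠ 2 * i.1 + 1 := by omega
    simp [h₁, h₂]
  · simp

lemma B_single_even (n : ℕ) (u : Fin (2*n) → ZMod 2) (i : Fin n) :
    B n u (Pi.single ⟨2*i.1, by have := i.2; omega⟩ 1) =
      u ⟨2*i.1+1, by have := i.2; omega⟩ := by
  rw [B_eq, Finset.sum_eq_single i]
  · simp
  · intro k _ hk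
    have h₁ : k.1 ≠ i.1 := fun h => hk (Fin.ext h)
    have h₂ : 2 * k.1 + 1 ≠ 2 * i.1 := by omega
    simp [h₁, h₂]
  · simp

lemma perp_PiSub (n : ℕ) : perp n (PiSub n) = PiSub n := by
  ext v
  refine ⟨fun h => (mem_PiSub_iff n v).2 fun i => ?_, fun h w hw => ?_⟩
  · rw [← B_single_even n v i]
    exact h _ (Submodule.subset_span ⟨_, by simp, rfl⟩)
  · rw [mem_PiSub_iff] at h hw
    simp [B_eq, h, hw]

lemma perp_SigmaSub (n : ℕ) : perp n (SigmaSub n) = SigmaSub n := by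
  ext v
  refine ⟨fun h => (mem_SigmaSub_iff n v).2 fun i => ?_, fun h w hw => ?_⟩
  · rw [← B_single_odd n v i]
    exact h _ (Submodule.subset_span ⟨_, by simp, rfl⟩)
  · rw [mem_SigmaSub_iff] at h hw
    simp [B_eq, h, hw]

lemma Q_eq_zero_of_mem_PiSub {n : ℕ} {v : Fin (2*n) → ZMod 2} (hv : v ∈ PiSub n) :
    Q n v = 0 := by
  rw [mem_PiSub_iff] at hv
  simp [Q, hv]

lemma Q_eq_zero_of_mem_SigmaSub {n : ℕ} {v : Fin (2*n) → ZMod 2} (hv : v ∈ SigmaSub n) :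
    Q n v = 0 := by
  rw [mem_SigmaSub_iff] at hv
  simp [Q, hv]

lemma eq_zero_of_mem_PiSub_of_mem_SigmaSub {n : ℕ} {v : Fin (2*n) → ZMod 2}
    (hP : v ∈ PiSub n) (hS : v ∈ SigmaSub n) : v = 0 := by
  rw [mem_PiSub_iff] at hP
  rw [mem_SigmaSub_iff] at hS
  ext j
  rw [Pi.zero_apply]
  rcases Nat.mod_two_eq_zero_or_one j.1 with hj | hj
  · convert hS ⟨j.1 / 2, by have := j.2; omega⟩
    simp only
    omega
  · convert hP ⟨j.1 / 2, by have := j.2; omega⟩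
    simp only
    omega

lemma exists_add_eq_of_PiSub_SigmaSub (n : ℕ) (x : Fin (2*n) → ZMod 2) :
    ∃ p ∈ PiSub n, ∃ s ∈ SigmaSub n, p + s = x := by
  refine ⟨fun j => if j.1 % 2 = 0 then x j else 0, ?_,
    fun j => if j.1 % 2 = 0 then 0 else x j, ?_, ?_⟩
  · rw [mem_PiSub_iff]
    intro i
    exact if_neg (by simp only; omega)
  · rw [mem_SigmaSub_iff]
    intro i
    exact if_pos (by simp only; omega)
  · ext j
    by_cases hj : j.1 % 2 = 0 <;> simp [hj]

lemma mem_perp_span_singleton_iff (n : ℕ) (x v : Fin (2*n) → ZMod 2) :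
    v ∈ perp n (Submodule.span (ZMod 2) {x}) ↔ B n x v = 0 := by
  refine ⟨fun h => B_comm n x v ▸ h x (Submodule.mem_span_singleton_self x), ?_⟩
  rintro h s hs
  obtain ⟨c, rfl⟩ := Submodule.mem_span_singleton.1 hs
  rw [B_comm, B_smul_left, h, mul_zero]

lemma perp_span_inf_eq_iff (n : ℕ) (S : Submodule (ZMod 2) (Fin (2*n) → ZMod 2))
    (x x' : Fin (2*n) → ZMod 2) :
    perp n (Submodule.span (ZMod 2) {x}) ⊓ S = perp n (Submodule.span (ZMod 2) {x'}) ⊓ S ↔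
      x + x' ∈ perp n S := by
  have key : ∀ a b : ZMod 2, a + b = 0 ↔ (a = 0 ↔ b = 0) := by decide
  change _ ↔ ∀ s ∈ S, B n (x + x') s = 0
  simp only [SetLike.ext_iff, Submodule.mem_inf, mem_perp_span_singleton_iff, B_add_left, key,
    and_congr_left_iff]

lemma perp_anti {n : ℕ} {S T : Submodule (ZMod 2) (Fin (2*n) → ZMod 2)} (h : S ≤ T) :
    perp n T ≤ perp n S :=
  fun _ hv s hs => hv s (h hs)

lemma le_of_antiflagMap_fst_le {n : ℕ} {x x' : Fin (2*n) → ZMod 2}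
    (h : (antiflagMap n x).1 ≤ (antiflagMap n x').1) :
    perp n (Submodule.span (ZMod 2) {x'}) ⊓ PiSub n ≤
      perp n (Submodule.span (ZMod 2) {x}) ⊓ PiSub n := by
  have hPi (y : Fin (2*n) → ZMod 2) :
      PiSub n ≤ perp n (perp n (Submodule.span (ZMod 2) {y}) ⊓ PiSub n) :=
    (perp_PiSub n).ge.trans (perp_anti inf_le_right)
  obtain ⟨p, hp, s, hs, hps⟩ := exists_add_eq_of_PiSub_SigmaSub n x
  have hx : x ∈ perp n (perp n (Submodule.span (ZMod 2) {x}) ⊓ PiSub n) :=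
    fun v hv => (mem_perp_span_singleton_iff n x v).1 hv.1
  have hsx : s ∈ (antiflagMap n x).1 := by
    refine ⟨?_, hs⟩
    rw [← hps] at hx ⊢
    exact (Submodule.add_mem_iff_right _ (hPi _ hp)).1 hx
  have hx' : x ∈ perp n (perp n (Submodule.span (ZMod 2) {x'}) ⊓ PiSub n) :=
    hps ▸ Submodule.add_mem _ (hPi x' hp) (h hsx).1
  exact fun v hv => ⟨(mem_perp_span_singleton_iff n x v).2 (hx' v hv), hv.2⟩

lemma antiflagMap_fst_eq_iff (n : ℕ) (x x' : Fin (2*n) → ZMod 2) :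
    (antiflagMap n x).1 = (antiflagMap n x').1 ↔ x + x' ∈ PiSub n := by
  conv_rhs => rw [← perp_PiSub, ← perp_span_inf_eq_iff]
  refine ⟨fun h => ?_, fun h => ?_⟩
  · exact le_antisymm (le_of_antiflagMap_fst_le h.ge) (le_of_antiflagMap_fst_le h.le)
  · simp only [antiflagMap, h]

lemma antiflagMap_snd_eq_iff (n : ℕ) (x x' : Fin (2*n) → ZMod 2) :
    (antiflagMap n x).2 = (antiflagMap n x').2 ↔ x + x' ∈ SigmaSub n := by
  conv_rhs => rw [← perp_SigmaSub]
  exact perp_span_inf_eq_iff n (SigmaSub n) x x'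

/-- Main Theorem, case `i = 3`: for distinct nonsingular vectors `x, x'` with
`f x = (P, H)` and `f x' = (P', H')`, relation `C₃` — `x + x'` is singular and lies
in `Π` or `Σ` — holds if and only if either `P = P'` and `H ≠ H'`, or `P ≠ P'` and
`H = H'` (relation `A₃`). -/
theorem main_case_three (n : ℕ) (hn : 2 ≤ n) (x x' : Fin (2*n) → ZMod 2)
    (hxx' : x ≠ x') (hx : Q n x = 1) (hx' : Q n x' = 1) :
    (Q n (x + x') = 0 ∧ (x + x' ∈ PiSub n ∨ x + x' ∈ SigmaSub n)) ↔
      (((antiflagMap n x).1 = (antiflagMap n x').1 ∧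
          (antiflagMap n x).2 ≠ (antiflagMap n x').2) ∨
        ((antiflagMap n x).1 ≠ (antiflagMap n x').1 ∧
          (antiflagMap n x).2 = (antiflagMap n x').2)) := by
  have hne : ¬ (x + x' ∈ PiSub n ∧ x + x' ∈ SigmaSub n) := fun h =>
    hxx' (funext fun j => CharTwo.add_eq_zero.1
      (congrFun (eq_zero_of_mem_PiSub_of_mem_SigmaSub h.1 h.2) j))
  have hQ : x + x' ∈ PiSub n ∨ x + x' ∈ SigmaSub n → Q n (x + x') = 0 := fun h =>
    h.elim Q_eq_zero_of_mem_PiSub Q_eq_zero_of_mem_SigmaSub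
  rw [Ne, Ne, antiflagMap_fst_eq_iff, antiflagMap_snd_eq_iff]
  tauto
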